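/- (Theorem 4.14, completeness) For all polarized formulas N (negative) and P (positive), with the parameter set X instantiated to {N, P⊥}: if ⟦↓N⟧⁺ ⊆ ⟦P⟧⁺ holds in the syntactic phase model, then the focused presentation Π,Σ ⊢ is derivable for every Π ∈ τ*(N⊥) and every Σ ∈ τ*(P). -/

import Mathlib

mutual
/-- Positive polarized formulas.  `rsub P N` denotes `P⊘N`, `lsub N P` denotes `N⦸P`. -/
inductive PFm : Type
  | pos : Nat → PFm               -- atom p
  | tens : PFm → PFm → PFm        -- P ⊗ Q
  | rsub : PFm → NFm → PFm        -- P ⊘ N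
  | lsub : NFm → PFm → PFm        -- N ⦸ P
  | disj : PFm → PFm → PFm        -- P ∨ Q
  | down : NFm → PFm              -- ↓N
/-- Negative polarized formulas.  `rdiv M Q` denotes `M/Q`, `ldiv Q M` denotes `Q\M`. -/
inductive NFm : Type
  | neg : Nat → NFm               -- atom p̄
  | par : NFm → NFm → NFm         -- M ⊕ N
  | ldiv : PFm → NFm → NFm        -- Q \ M
  | rdiv : NFm → PFm → NFm        -- M / Q
  | conj : NFm → NFm → NFm        -- M ∧ N
  | up : PFm → NFm                -- ↑P
end

mutual
/-- Polarized linear negation (positive to negative). -/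
def PFm.dual : PFm → NFm
  | .pos n => .neg n
  | .tens P Q => .par Q.dual P.dual        -- (P⊗Q)⊥ = Q⊥⊕P⊥
  | .rsub P N => .ldiv N.dual P.dual       -- (P⊘N)⊥ = N⊥\P⊥
  | .lsub N P => .rdiv P.dual N.dual       -- (N⦸P)⊥ = P⊥/N⊥
  | .disj P Q => .conj Q.dual P.dual       -- (P∨Q)⊥ = Q⊥∧P⊥
  | .down N => .up N.dual                  -- (↓N)⊥ = ↑(N⊥)
/-- Polarized linear negation (negative to positive). -/
def NFm.dual : NFm → PFm
  | .neg n => .pos n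
  | .par M N => .tens N.dual M.dual        -- (M⊕N)⊥ = N⊥⊗M⊥
  | .ldiv Q M => .rsub M.dual Q.dual       -- (Q\M)⊥ = M⊥⊘Q⊥
  | .rdiv M Q => .lsub Q.dual M.dual       -- (M/Q)⊥ = Q⊥⦸M⊥
  | .conj M N => .disj N.dual M.dual       -- (M∧N)⊥ = N⊥∨M⊥
  | .up P => .down P.dual                  -- (↑P)⊥ = ↓(P⊥)
end
/-- A polarized formula: either positive or negative. -/
abbrev Pol : Type := PFm ⊕ NFm

mutual
/-- The subformula map σ on negative polarized formulas. -/
def ssig : NFm → Set Pol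
  | .up P => insert (Sum.inr P.dual) (ttau P)       -- σ(↑P) = {P⊥} ∪ τ(P)
  | .neg n => {Sum.inr (.neg n)}
  | .conj M N => ssig M ∪ ssig N
  | .par M N => ssig M ∪ ssig N
  | .rdiv M Q => ssig M ∪ ttau Q
  | .ldiv Q M => ssig M ∪ ttau Q
/-- The subformula map τ on positive polarized formulas. -/
def ttau : PFm → Set Pol
  | .down N => insert (Sum.inr N) (ssig N)          -- τ(↓N) = {N} ∪ σ(N)
  | .pos n => {Sum.inl (.pos n)}
  | .disj P Q => ttau P ∪ ttau Q
  | .tens P Q => ttau P ∪ ttau Q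
  | .lsub N P => ttau P ∪ ssig N
  | .rsub P N => ttau P ∪ ssig N
end

/-- The closure X^τ = ⋃ { τ(↓N) | N ∈ X } of a set X of negative formulas. -/
def Xtau (X : Set NFm) : Set Pol := {a | ∃ N ∈ X, a ∈ ttau (.down N)}
/-- Focused structures: π ::= p | N | π·⊗·σ | π·⊘·σ | σ·⦸·π, where a negative formula `N`
stands for its implicit ↓-shift.  `slsub σ π` denotes `σ·⦸·π`, `srsub π σ` denotes `π·⊘·σ`. -/
inductive FStr : Type
  | at : Nat → FStr
  | nfm : NFm → FStr
  | stens : FStr → FStr → FStr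
  | srsub : FStr → FStr → FStr
  | slsub : FStr → FStr → FStr

/-- The decomposition relation `Tstar P σ`, i.e. `σ ∈ τ*(P)`:
τ*(P⊗Q)={π·⊗·σ | π∈τ*(P), σ∈τ*(Q)}, τ*(P⊘N)={π·⊘·σ | π∈τ*(P), σ∈τ*(N⊥)},
τ*(N⦸P)={σ·⦸·π | π∈τ*(P), σ∈τ*(N⊥)}, τ*(P∨Q)=τ*(P)∪τ*(Q), τ*(p)={p}, τ*(↓N)={N}. -/
inductive Tstar : PFm → FStr → Prop
  | tens {P Q π σ} : Tstar P π → Tstar Q σ → Tstar (.tens P Q) (.stens π σ)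
  | rsub {P N π σ} : Tstar P π → Tstar N.dual σ → Tstar (.rsub P N) (.srsub π σ)
  | lsub {N P π σ} : Tstar P π → Tstar N.dual σ → Tstar (.lsub N P) (.slsub σ π)
  | disjl {P Q π} : Tstar P π → Tstar (.disj P Q) π
  | disjr {P Q π} : Tstar Q π → Tstar (.disj P Q) π
  | at {n} : Tstar (.pos n) (.at n)
  | down {N} : Tstar (.down N) (.nfm N)
/-- One-hole contexts over focused structures. -/
inductive FCtx : Type
  | hole : FCtx
  | tensL : FCtx → FStr → FCtx      -- π[]·⊗·σ
  | tensR : FStr → FCtx → FCtx      -- π·⊗·σ[]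
  | rsubL : FCtx → FStr → FCtx      -- π[]·⊘·σ
  | rsubR : FStr → FCtx → FCtx      -- π·⊘·σ[]
  | lsubL : FCtx → FStr → FCtx      -- σ[]·⦸·π
  | lsubR : FStr → FCtx → FCtx      -- σ·⦸·π[]

/-- Substitution `π[υ]` of a structure for the hole of a context. -/
def FCtx.fill : FCtx → FStr → FStr
  | .hole, υ => υ
  | .tensL c σ, υ => .stens (c.fill υ) σ
  | .tensR π c, υ => .stens π (c.fill υ)
  | .rsubL c σ, υ => .srsub (c.fill υ) σ
  | .rsubR π c, υ => .srsub π (c.fill υ)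
  | .lsubL c π, υ => .slsub (c.fill υ) π
  | .lsubR σ c, υ => .slsub σ (c.fill υ)

/-- The display map `π[] ÷ υ`. -/
def FCtx.div : FCtx → FStr → FStr
  | .hole, υ => υ
  | .tensL c σ, υ => c.div (.slsub σ υ)       -- (π[]·⊗·σ)÷υ = π[]÷(σ·⦸·υ)
  | .tensR π c, υ => c.div (.srsub υ π)       -- (π·⊗·σ[])÷υ = σ[]÷(υ·⊘·π)
  | .rsubL c σ, υ => c.div (.stens σ υ)       -- (π[]·⊘·σ)÷υ = π[]÷(σ·⊗·υ)
  | .rsubR π c, υ => c.div (.slsub υ π)       -- (π·⊘·σ[])÷υ = σ[]÷(υ·⦸·π)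
  | .lsubR σ c, υ => c.div (.stens υ σ)       -- (σ·⦸·π[])÷υ = π[]÷(υ·⊗·σ)
  | .lsubL c π, υ => c.div (.srsub π υ)       -- (σ[]·⦸·π)÷υ = σ[]÷(π·⊘·υ)
mutual
/-- Strongly focused derivability of presentations `π,σ ⊢`, relative to the parameter
set `X` of negative formulas.  The rule (D) covers both presentation contexts
`ω[] = ⟨π[],σ⟩` and `ω[] = ⟨σ,π[]⟩`, with `ω*[] = π[]÷σ`. -/
inductive FSeq (X : Set NFm) : FStr → FStr → Prop
  | decL {N σ'} (c : FCtx) (υ : FStr) : Sum.inr N ∈ Xtau X → Tstar N.dual σ' →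
      FFoc X (c.div υ) σ' → FSeq X (c.fill (.nfm N)) υ
  | decR {N σ'} (c : FCtx) (υ : FStr) : Sum.inr N ∈ Xtau X → Tstar N.dual σ' →
      FFoc X (c.div υ) σ' → FSeq X υ (c.fill (.nfm N))
/-- Strongly focused derivability `π ⊢f σ` (context splitting judgement). -/
inductive FFoc (X : Set NFm) : FStr → FStr → Prop
  | id {n} : FFoc X (.at n) (.at n)
  | react {π N} : (∀ σ, Tstar N.dual σ → FSeq X π σ) → FFoc X π (.nfm N)
  | tens {π π' σ σ'} : FFoc X π π' → FFoc X σ σ' → FFoc X (.stens π σ) (.stens π' σ')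
  | rsub {π π' σ σ'} : FFoc X σ σ' → FFoc X π π' → FFoc X (.srsub π σ) (.srsub π' σ')
  | lsub {π π' σ σ'} : FFoc X σ σ' → FFoc X π π' → FFoc X (.slsub σ π) (.slsub σ' π')
end
/-- The polar set A^⊥ of a set of focused structures in the syntactic phase model
(whose phases are the focused structures, with ⟨π,σ⟩ ∈ ⊥ iff `π,σ ⊢`). -/
def spol (X : Set NFm) (A : Set FStr) : Set FStr := {π | ∀ σ ∈ A, FSeq X π σ}

/-- A×B = {π·⊗·σ | π∈A^⊥, σ∈B^⊥}^⊥ in the syntactic model. -/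
def stimes (X : Set NFm) (A B : Set FStr) : Set FStr :=
  spol X {s | ∃ π ∈ spol X A, ∃ σ ∈ spol X B, s = FStr.stens π σ}
/-- A←B = {π·⊘·σ | π∈A^⊥, σ∈B^⊥}^⊥ in the syntactic model. -/
def slarr (X : Set NFm) (A B : Set FStr) : Set FStr :=
  spol X {s | ∃ π ∈ spol X A, ∃ σ ∈ spol X B, s = FStr.srsub π σ}
/-- A→B = {π·⦸·σ | π∈A^⊥, σ∈B^⊥}^⊥ in the syntactic model. -/
def srarr (X : Set NFm) (A B : Set FStr) : Set FStr :=
  spol X {s | ∃ π ∈ spol X A, ∃ σ ∈ spol X B, s = FStr.slsub π σ}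

mutual
/-- The interpretation ⟦P⟧⁺ in the syntactic phase model (with v(p) = {p}^⊥). -/
def sipos (X : Set NFm) : PFm → Set FStr
  | .pos n => spol X {FStr.at n}
  | .tens P Q => stimes X (sipos X P) (sipos X Q)
  | .rsub P N => slarr X (sipos X P) (sineg X N)
  | .lsub N P => srarr X (sineg X N) (sipos X P)
  | .disj P Q => sipos X P ∩ sipos X Q
  | .down N => spol X (sineg X N)
/-- The interpretation ⟦N⟧⁻ in the syntactic phase model. -/
def sineg (X : Set NFm) : NFm → Set FStr
  | .neg n => spol X {FStr.at n}
  | .par M N => stimes X (sineg X N) (sineg X M)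
  | .rdiv M Q => srarr X (sipos X Q) (sineg X M)
  | .ldiv Q M => slarr X (sineg X M) (sipos X Q)
  | .conj M N => sineg X M ∩ sineg X N
  | .up P => spol X (sipos X P)
end

mutual
theorem pdd : ∀ P : PFm, P.dual.dual = P
  | .pos n => by simp [PFm.dual, NFm.dual]
  | .tens P Q => by simp [PFm.dual, NFm.dual, pdd P, pdd Q]
  | .rsub P N => by simp [PFm.dual, NFm.dual, pdd P, ndd N]
  | .lsub N P => by simp [PFm.dual, NFm.dual, pdd P, ndd N]
  | .disj P Q => by simp [PFm.dual, NFm.dual, pdd P, pdd Q]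
  | .down N => by simp [PFm.dual, NFm.dual, ndd N]
theorem ndd : ∀ N : NFm, N.dual.dual = N
  | .neg n => by simp [PFm.dual, NFm.dual]
  | .par M N => by simp [PFm.dual, NFm.dual, ndd M, ndd N]
  | .ldiv Q M => by simp [PFm.dual, NFm.dual, pdd Q, ndd M]
  | .rdiv M Q => by simp [PFm.dual, NFm.dual, pdd Q, ndd M]
  | .conj M N => by simp [PFm.dual, NFm.dual, ndd M, ndd N]
  | .up P => by simp [PFm.dual, NFm.dual, pdd P]
end

mutual
theorem sineg_dual (X : Set NFm) : ∀ P : PFm, sineg X P.dual = sipos X P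
  | .pos n => by simp [PFm.dual, sineg, sipos]
  | .tens P Q => by simp [PFm.dual, sineg, sipos, sineg_dual X P, sineg_dual X Q]
  | .rsub P N => by simp [PFm.dual, sineg, sipos, sineg_dual X P, sipos_dual X N]
  | .lsub N P => by simp [PFm.dual, sineg, sipos, sineg_dual X P, sipos_dual X N]
  | .disj P Q => by
      simp [PFm.dual, sineg, sipos, sineg_dual X P, sineg_dual X Q, Set.inter_comm]
  | .down N => by simp [PFm.dual, sineg, sipos, sipos_dual X N]
theorem sipos_dual (X : Set NFm) : ∀ N : NFm, sipos X N.dual = sineg X N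
  | .neg n => by simp [NFm.dual, sineg, sipos]
  | .par M N => by simp [NFm.dual, sineg, sipos, sipos_dual X M, sipos_dual X N]
  | .ldiv Q M => by simp [NFm.dual, sineg, sipos, sineg_dual X Q, sipos_dual X M]
  | .rdiv M Q => by simp [NFm.dual, sineg, sipos, sineg_dual X Q, sipos_dual X M]
  | .conj M N => by
      simp [NFm.dual, sineg, sipos, sipos_dual X M, sipos_dual X N, Set.inter_comm]
  | .up P => by simp [NFm.dual, sineg, sipos, sineg_dual X P]
end

theorem FSeq.sym {X : Set NFm} {a b : FStr} (h : FSeq X a b) : FSeq X b a := by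
  cases h with
  | decL c υ h1 h2 h3 => exact .decR c _ h1 h2 h3
  | decR c υ h1 h2 h3 => exact .decL c _ h1 h2 h3

/-- Derivability with a decision inside the first component. -/
def DecIn (X : Set NFm) (a b : FStr) : Prop :=
  ∃ c N σ', a = FCtx.fill c (.nfm N) ∧ Sum.inr N ∈ Xtau X ∧ Tstar N.dual σ' ∧ FFoc X (c.div b) σ'

theorem fseq_iff {X : Set NFm} {a b : FStr} : FSeq X a b ↔ DecIn X a b ∨ DecIn X b a := by
  constructor
  · intro h
    cases h with
    | decL c υ h1 h2 h3 => exact .inl ⟨c, _, _, rfl, h1, h2, h3⟩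
    | decR c υ h1 h2 h3 => exact .inr ⟨c, _, _, rfl, h1, h2, h3⟩
  · rintro (⟨c, N, σ, rfl, h1, h2, h3⟩ | ⟨c, N, σ, rfl, h1, h2, h3⟩)
    · exact .decL c _ h1 h2 h3
    · exact .decR c _ h1 h2 h3

theorem decIn_tens {X : Set NFm} {a b c : FStr} :
    DecIn X (.stens a b) c ↔ DecIn X a (.slsub b c) ∨ DecIn X b (.srsub c a) := by
  constructor
  · rintro ⟨k, N, σ, e, h1, h2, h3⟩
    cases k <;> simp only [FCtx.fill, FStr.stens.injEq, reduceCtorEq] at e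
    · obtain ⟨rfl, rfl⟩ := e
      exact .inl ⟨_, _, _, rfl, h1, h2, h3⟩
    · obtain ⟨rfl, rfl⟩ := e
      exact .inr ⟨_, _, _, rfl, h1, h2, h3⟩
  · rintro (⟨k, N, σ, rfl, h1, h2, h3⟩ | ⟨k, N, σ, rfl, h1, h2, h3⟩)
    · exact ⟨.tensL k b, N, σ, rfl, h1, h2, h3⟩
    · exact ⟨.tensR a k, N, σ, rfl, h1, h2, h3⟩

theorem decIn_rsub {X : Set NFm} {a b c : FStr} :
    DecIn X (.srsub a b) c ↔ DecIn X a (.stens b c) ∨ DecIn X b (.slsub c a) := by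
  constructor
  · rintro ⟨k, N, σ, e, h1, h2, h3⟩
    cases k <;> simp only [FCtx.fill, FStr.srsub.injEq, reduceCtorEq] at e
    · obtain ⟨rfl, rfl⟩ := e
      exact .inl ⟨_, _, _, rfl, h1, h2, h3⟩
    · obtain ⟨rfl, rfl⟩ := e
      exact .inr ⟨_, _, _, rfl, h1, h2, h3⟩
  · rintro (⟨k, N, σ, rfl, h1, h2, h3⟩ | ⟨k, N, σ, rfl, h1, h2, h3⟩)
    · exact ⟨.rsubL k b, N, σ, rfl, h1, h2, h3⟩
    · exact ⟨.rsubR a k, N, σ, rfl, h1, h2, h3⟩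

theorem decIn_lsub {X : Set NFm} {a b c : FStr} :
    DecIn X (.slsub a b) c ↔ DecIn X a (.srsub b c) ∨ DecIn X b (.stens c a) := by
  constructor
  · rintro ⟨k, N, σ, e, h1, h2, h3⟩
    cases k <;> simp only [FCtx.fill, FStr.slsub.injEq, reduceCtorEq] at e
    · obtain ⟨rfl, rfl⟩ := e
      exact .inl ⟨_, _, _, rfl, h1, h2, h3⟩
    · obtain ⟨rfl, rfl⟩ := e
      exact .inr ⟨_, _, _, rfl, h1, h2, h3⟩
  · rintro (⟨k, N, σ, rfl, h1, h2, h3⟩ | ⟨k, N, σ, rfl, h1, h2, h3⟩)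
    · exact ⟨.lsubL k b, N, σ, rfl, h1, h2, h3⟩
    · exact ⟨.lsubR a k, N, σ, rfl, h1, h2, h3⟩

theorem disp1 {X : Set NFm} {a b c : FStr} :
    FSeq X (.stens a b) c ↔ FSeq X a (.slsub b c) := by
  simp only [fseq_iff, decIn_tens, decIn_lsub]; tauto

theorem disp2 {X : Set NFm} {a b c : FStr} :
    FSeq X (.stens a b) c ↔ FSeq X b (.srsub c a) := by
  simp only [fseq_iff, decIn_tens, decIn_rsub]; tauto

theorem disp3 {X : Set NFm} {a b c : FStr} :
    FSeq X (.srsub a b) c ↔ FSeq X b (.slsub c a) := by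
  simp only [fseq_iff, decIn_lsub, decIn_rsub]; tauto

theorem fseq_comm {X : Set NFm} {a b : FStr} : FSeq X a b ↔ FSeq X b a :=
  ⟨FSeq.sym, FSeq.sym⟩

/-- `T` generates `A`. -/
def Good (X : Set NFm) (A : Set FStr) (T : FStr → Prop) : Prop :=
  (∀ s, T s → s ∈ spol X A) ∧ spol X {s | ∃ t, T t ∧ FFoc X s t} ⊆ A

theorem good_op {X : Set NFm} {A B : Set FStr} {T U V : FStr → Prop} (f g h : FStr → FStr → FStr)
    (d1 : ∀ a b c, FSeq X (f a b) c ↔ FSeq X a (g b c))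
    (d2 : ∀ a b c, FSeq X (f a b) c ↔ FSeq X b (h c a))
    (hf : ∀ a b a' b', FFoc X a a' → FFoc X b b' → FFoc X (f a b) (f a' b'))
    (hA : Good X A T) (hB : Good X B U) (hV : ∀ s, V s ↔ ∃ a b, T a ∧ U b ∧ s = f a b) :
    Good X (spol X {s | ∃ π ∈ spol X A, ∃ σ ∈ spol X B, s = f π σ}) V := by
  constructor
  · intro s hs
    obtain ⟨a, b, ha, hb, rfl⟩ := (hV s).1 hs
    intro y hy
    exact (hy _ ⟨a, hA.1 a ha, b, hB.1 b hb, rfl⟩).sym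
  · rintro y hy s ⟨a, ha, b, hb, rfl⟩
    refine FSeq.sym ((d1 _ _ _).2 (ha _ (hA.2 ?_)))
    rintro a0 ⟨a1, ha1, hfa⟩
    refine FSeq.sym ((d1 _ _ _).1 ((d2 _ _ _).2 (hb _ (hB.2 ?_))))
    rintro b0 ⟨b1, hb1, hfb⟩
    refine FSeq.sym ((d2 _ _ _).1 (FSeq.sym (hy _ ⟨f a1 b1, ?_, hf _ _ _ _ hfa hfb⟩)))
    exact (hV _).2 ⟨_, _, ha1, hb1, rfl⟩

theorem good_tens {X : Set NFm} {A B : Set FStr} {T U V : FStr → Prop}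
    (hA : Good X A T) (hB : Good X B U) (hV : ∀ s, V s ↔ ∃ a b, T a ∧ U b ∧ s = .stens a b) :
    Good X (stimes X A B) V :=
  good_op .stens .slsub .srsub (fun _ _ _ => disp1) (fun _ _ _ => disp2)
    (fun _ _ _ _ => .tens) hA hB hV

theorem good_rsub {X : Set NFm} {A B : Set FStr} {T U V : FStr → Prop}
    (hA : Good X A T) (hB : Good X B U) (hV : ∀ s, V s ↔ ∃ a b, T a ∧ U b ∧ s = .srsub a b) :
    Good X (slarr X A B) V :=
  good_op .srsub .stens .slsub
    (fun _ _ _ => by rw [fseq_comm, ← disp2, fseq_comm]) (fun _ _ _ => disp3)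
    (fun _ _ _ _ h1 h2 => .rsub h2 h1) hA hB hV

theorem good_lsub {X : Set NFm} {A B : Set FStr} {T U V : FStr → Prop}
    (hA : Good X A T) (hB : Good X B U) (hV : ∀ s, V s ↔ ∃ a b, T a ∧ U b ∧ s = .slsub a b) :
    Good X (srarr X A B) V :=
  good_op .slsub .srsub .stens
    (fun _ _ _ => by rw [fseq_comm, ← disp3, fseq_comm])
    (fun _ _ _ => by rw [fseq_comm, ← disp1, fseq_comm])
    (fun _ _ _ _ h1 h2 => .lsub h1 h2) hA hB hV

theorem good_inter {X : Set NFm} {A B : Set FStr} {T U V : FStr → Prop}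
    (hA : Good X A T) (hB : Good X B U) (hV : ∀ s, V s ↔ T s ∨ U s) :
    Good X (A ∩ B) V := by
  constructor
  · intro s hs y hy
    rcases (hV s).1 hs with h | h
    · exact hA.1 s h y hy.1
    · exact hB.1 s h y hy.2
  · intro y hy
    refine ⟨hA.2 ?_, hB.2 ?_⟩
    · rintro s ⟨t, ht, hf⟩
      exact hy s ⟨t, (hV t).2 (.inl ht), hf⟩
    · rintro s ⟨t, ht, hf⟩
      exact hy s ⟨t, (hV t).2 (.inr ht), hf⟩

theorem good_atom {X : Set NFm} {n : ℕ} {V : FStr → Prop} (hV : ∀ s, V s ↔ s = .at n) :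
    Good X (spol X {FStr.at n}) V := by
  constructor
  · intro s hs y hy
    rw [(hV s).1 hs]
    exact (hy _ rfl).sym
  · rintro y hy s rfl
    exact hy _ ⟨_, (hV _).2 rfl, .id⟩

theorem good_shift {X : Set NFm} {A : Set FStr} {M : NFm} {V : FStr → Prop}
    (hM : Sum.inr M ∈ Xtau X) (hA : Good X A (Tstar M.dual)) (hV : ∀ s, V s ↔ s = .nfm M) :
    Good X (spol X A) V := by
  constructor
  · intro s hs y hy
    rw [(hV s).1 hs]
    have : FStr.nfm M ∈ A := by
      apply hA.2
      rintro s ⟨t, ht, hf⟩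
      exact .decL .hole s hM ht hf
    exact (hy _ this).sym
  · intro y hy s hs
    refine hy s ⟨.nfm M, (hV _).2 rfl, .react ?_⟩
    intro t ht
    exact (hA.1 t ht s hs).sym

theorem ts_tens (P Q : PFm) (s : FStr) :
    Tstar (.tens P Q) s ↔ ∃ a b, Tstar P a ∧ Tstar Q b ∧ s = .stens a b := by
  constructor
  · rintro ⟨⟩; exact ⟨_, _, ‹_›, ‹_›, rfl⟩
  · rintro ⟨a, b, h1, h2, rfl⟩; exact .tens h1 h2

theorem ts_rsub (P : PFm) (N : NFm) (s : FStr) :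
    Tstar (.rsub P N) s ↔ ∃ a b, Tstar P a ∧ Tstar N.dual b ∧ s = .srsub a b := by
  constructor
  · rintro ⟨⟩; exact ⟨_, _, ‹_›, ‹_›, rfl⟩
  · rintro ⟨a, b, h1, h2, rfl⟩; exact .rsub h1 h2

theorem ts_lsub (P : PFm) (N : NFm) (s : FStr) :
    Tstar (.lsub N P) s ↔ ∃ a b, Tstar N.dual a ∧ Tstar P b ∧ s = .slsub a b := by
  constructor
  · rintro ⟨⟩; exact ⟨_, _, ‹_›, ‹_›, rfl⟩
  · rintro ⟨a, b, h1, h2, rfl⟩; exact .lsub h2 h1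

theorem ts_disj (P Q : PFm) (s : FStr) : Tstar (.disj P Q) s ↔ Tstar P s ∨ Tstar Q s := by
  constructor
  · rintro ⟨⟩
    · exact .inl ‹_›
    · exact .inr ‹_›
  · rintro (h | h)
    · exact .disjl h
    · exact .disjr h

theorem ts_pos (n : ℕ) (s : FStr) : Tstar (.pos n) s ↔ s = .at n := by
  constructor
  · rintro ⟨⟩; rfl
  · rintro rfl; exact .at

theorem ts_down (N : NFm) (s : FStr) : Tstar (.down N) s ↔ s = .nfm N := by
  constructor
  · rintro ⟨⟩; rfl
  · rintro rfl; exact .down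

mutual
theorem good_pos (X : Set NFm) : ∀ P : PFm, ttau P ⊆ Xtau X → Good X (sipos X P) (Tstar P)
  | .pos n, _ => by rw [sipos]; exact good_atom (ts_pos n)
  | .tens P Q, h => by
      rw [ttau, Set.union_subset_iff] at h
      rw [sipos]; exact good_tens (good_pos X P h.1) (good_pos X Q h.2) (ts_tens P Q)
  | .rsub P N, h => by
      rw [ttau, Set.union_subset_iff] at h
      rw [sipos]; exact good_rsub (good_pos X P h.1) (good_neg X N h.2) (ts_rsub P N)
  | .lsub N P, h => by
      rw [ttau, Set.union_subset_iff] at h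
      rw [sipos]; exact good_lsub (good_neg X N h.2) (good_pos X P h.1) (ts_lsub P N)
  | .disj P Q, h => by
      rw [ttau, Set.union_subset_iff] at h
      rw [sipos]; exact good_inter (good_pos X P h.1) (good_pos X Q h.2) (ts_disj P Q)
  | .down N, h => by
      rw [ttau, Set.insert_subset_iff] at h
      rw [sipos]; exact good_shift h.1 (good_neg X N h.2) (ts_down N)
theorem good_neg (X : Set NFm) : ∀ N : NFm, ssig N ⊆ Xtau X → Good X (sineg X N) (Tstar N.dual)
  | .neg n, _ => by rw [sineg, NFm.dual]; exact good_atom (ts_pos n)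
  | .par M N, h => by
      rw [ssig, Set.union_subset_iff] at h
      rw [sineg, NFm.dual]
      exact good_tens (good_neg X N h.2) (good_neg X M h.1) (ts_tens _ _)
  | .ldiv Q M, h => by
      rw [ssig, Set.union_subset_iff] at h
      rw [sineg, NFm.dual]
      refine good_rsub (good_neg X M h.1) (good_pos X Q h.2) ?_
      have := ts_rsub M.dual Q.dual
      rwa [pdd] at this
  | .rdiv M Q, h => by
      rw [ssig, Set.union_subset_iff] at h
      rw [sineg, NFm.dual]
      refine good_lsub (good_pos X Q h.2) (good_neg X M h.1) ?_
      have := ts_lsub M.dual Q.dual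
      rwa [pdd] at this
  | .conj M N, h => by
      rw [ssig, Set.union_subset_iff] at h
      rw [sineg, NFm.dual, Set.inter_comm]
      exact good_inter (good_neg X N h.2) (good_neg X M h.1) (ts_disj _ _)
  | .up P, h => by
      rw [ssig, Set.insert_subset_iff] at h
      rw [sineg, NFm.dual]
      refine good_shift h.1 ?_ (ts_down _)
      rw [pdd]
      exact good_pos X P h.2
end

/-- Theorem 4.14, completeness: with the parameter set X = {N, P⊥},
if ⟦↓N⟧⁺ ⊆ ⟦P⟧⁺ holds in the syntactic phase model, then the focused presentation
`π,σ ⊢` is derivable for every π ∈ τ*(N⊥) and σ ∈ τ*(P). -/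
theorem syntactic_completeness (N : NFm) (P : PFm)
    (h : sipos {N, P.dual} (.down N) ⊆ sipos {N, P.dual} P) :
    ∀ π σ : FStr, Tstar N.dual π → Tstar P σ → FSeq {N, P.dual} π σ := by
  have hX : ∀ M ∈ ({N, P.dual} : Set NFm), ssig M ⊆ Xtau {N, P.dual} := by
    intro M hM a ha
    refine ⟨M, hM, ?_⟩
    rw [ttau]
    exact Set.mem_insert_of_mem _ ha
  have gN := good_neg {N, P.dual} N (hX N (by simp))
  have gP := good_neg {N, P.dual} P.dual (hX P.dual (by simp))
  rw [sineg_dual, pdd] at gP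
  intro π σ hπ hσ
  refine (gP.1 σ hσ π (h ?_)).sym
  rw [sipos]
  exact gN.1 π hπ
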